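/- The Yang–Mills kinematic differential m₁ satisfies the graded Leibniz rule with respect to the worldline vertex-operator product μ₂: for all smooth inputs, (i) m₁(λ₁λ₂) = μ₂(m₁λ₁, λ₂) + μ₂(λ₁, m₁λ₂) in K₁; (ii) m₁(μ₂(λ,(A,φ))) = μ₂(m₁λ,(A,φ)) + μ₂(λ, m₁(A,φ)) in K₂; (iii) m₁(μ₂((A,φ),λ)) = μ₂(m₁(A,φ),λ) − μ₂((A,φ), m₁λ) in K₂; (iv) m₁(μ₂((A₁,φ₁),(A₂,φ₂))) = μ₂(m₁(A₁,φ₁),(A₂,φ₂)) − μ₂((A₁,φ₁), m₁(A₂,φ₂)) in K₃; (v) m₁(μ₂(λ,(E,e))) = μ₂(m₁λ,(E,e)) + μ₂(λ, m₁(E,e)) in K₃; (vi) m₁(μ₂((E,e),λ)) = μ₂(m₁(E,e),λ) + μ₂((E,e), m₁λ) in K₃. -/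

import Mathlib

noncomputable section

/-- Points of ℝ^D. -/
abbrev Pt (D : ℕ) := Fin D → ℝ
/-- Scalar fields on ℝ^D. -/
abbrev Fn (D : ℕ) := Pt D → ℝ
/-- Vector fields on ℝ^D (components carry a lower Lorentz index). -/
abbrev Vec (D : ℕ) := Pt D → Fin D → ℝ

/-- Diagonal entries of the Minkowski metric η = diag(−1,1,…,1) (η is its own inverse). -/
def eta (D : ℕ) (μ : Fin D) : ℝ := if (μ : ℕ) = 0 then -1 else 1

/-- Partial derivative ∂_μ. -/
def pd {D : ℕ} (μ : Fin D) (f : Fn D) : Fn D := fun x => fderiv ℝ f x (Pi.single μ 1)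

/-- Minkowski pairing X·Y = η^{μν} X_μ Y_ν. -/
def dot {D : ℕ} (X Y : Vec D) : Fn D := fun x => ∑ μ, eta D μ * X x μ * Y x μ

/-- Divergence ∂·X = ∂^μ X_μ. -/
def divg {D : ℕ} (X : Vec D) : Fn D := fun x => ∑ μ, eta D μ * pd μ (fun y => X y μ) x

/-- Gradient (∂f)_μ = ∂_μ f. -/
def grad {D : ℕ} (f : Fn D) : Vec D := fun x μ => pd μ f x

/-- Wave operator □ = ∂^μ∂_μ on scalars. -/
def box {D : ℕ} (f : Fn D) : Fn D := fun x => ∑ μ, eta D μ * pd μ (pd μ f) x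

/-- Wave operator acting componentwise on vector fields. -/
def boxV {D : ℕ} (X : Vec D) : Vec D := fun x μ => box (fun y => X y μ) x

/-- Generalized Lie derivative product: (X*Y)_μ = X^ν ∂_ν Y_μ + (∂_μ X_ν − ∂_ν X_μ) Y^ν. -/
def starP {D : ℕ} (X Y : Vec D) : Vec D := fun x μ =>
  ∑ ν, eta D ν * (X x ν * pd ν (fun y => Y y μ) x
    + (pd μ (fun y => X y ν) x - pd ν (fun y => X y μ) x) * Y x ν)

/-- Bullet product X•Y = (∂·X)Y − (∂·Y)X + X*Y − Y*X. -/
def bullet {D : ℕ} (X Y : Vec D) : Vec D :=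
  fun x μ => divg X x * Y x μ - divg Y x * X x μ + starP X Y x μ - starP Y X x μ

/-- Pointwise product of scalar fields. -/
def fmul {D : ℕ} (f g : Fn D) : Fn D := fun x => f x * g x

/-- Pointwise scaling of a vector field by a scalar field. -/
def fsmul {D : ℕ} (f : Fn D) (X : Vec D) : Vec D := fun x μ => f x * X x μ

/-- Smoothness of scalar fields. -/
def SmF {D : ℕ} (f : Fn D) : Prop := ContDiff ℝ (⊤ : ℕ∞) f

/-- Smoothness of vector fields. -/
def SmV {D : ℕ} (X : Vec D) : Prop := ∀ μ, ContDiff ℝ (⊤ : ℕ∞) fun x => X x μ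

/-- Differential m₁ : K₀ → K₁, λ ↦ (∂λ, □λ). -/
def m1₀ {D : ℕ} (l : Fn D) : Vec D × Fn D := (grad l, box l)

/-- Differential m₁ : K₁ → K₂, (A,φ) ↦ (□A − ∂φ, ∂·A − φ). -/
def m1₁ {D : ℕ} (a : Vec D × Fn D) : Vec D × Fn D :=
  (fun x μ => boxV a.1 x μ - grad a.2 x μ, fun x => divg a.1 x - a.2 x)

/-- Differential m₁ : K₂ → K₃, (E,e) ↦ □e − ∂·E. -/
def m1₂ {D : ℕ} (e : Vec D × Fn D) : Fn D := fun x => box e.2 x - divg e.1 x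

/-- μ₂ on K₀ ⊗ K₀. -/
def mu2₀₀ {D : ℕ} (l1 l2 : Fn D) : Fn D := fmul l1 l2

/-- μ₂ on K₀ ⊗ K₁: μ₂(λ,(A,φ)) = (λA, λφ). -/
def mu2₀₁ {D : ℕ} (l : Fn D) (a : Vec D × Fn D) : Vec D × Fn D := (fsmul l a.1, fmul l a.2)

/-- μ₂ on K₁ ⊗ K₀: μ₂((A,φ),λ) = (λA, λφ + 2A·∂λ). -/
def mu2₁₀ {D : ℕ} (a : Vec D × Fn D) (l : Fn D) : Vec D × Fn D :=
  (fsmul l a.1, fun x => l x * a.2 x + 2 * dot a.1 (grad l) x)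

/-- μ₂ on K₀ ⊗ K₂: μ₂(λ,(E,e)) = (λE, λe). -/
def mu2₀₂ {D : ℕ} (l : Fn D) (e : Vec D × Fn D) : Vec D × Fn D := (fsmul l e.1, fmul l e.2)

/-- μ₂ on K₂ ⊗ K₀: μ₂((E,e),λ) = μ₂(λ,(E,e)). -/
def mu2₂₀ {D : ℕ} (e : Vec D × Fn D) (l : Fn D) : Vec D × Fn D := (fsmul l e.1, fmul l e.2)

/-- μ₂ on K₁ ⊗ K₁: μ₂((A₁,φ₁),(A₂,φ₂)) = (φ₁A₂ − φ₂A₁ + 2A₁*A₂, A₁·A₂). -/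
def mu2₁₁ {D : ℕ} (a1 a2 : Vec D × Fn D) : Vec D × Fn D :=
  (fun x μ => a1.2 x * a2.1 x μ - a2.2 x * a1.1 x μ + 2 * starP a1.1 a2.1 x μ,
   dot a1.1 a2.1)

/-- μ₂ on K₁ ⊗ K₂: μ₂((A,φ),(E,e)) = −A·E + φe + 2A·∂e. -/
def mu2₁₂ {D : ℕ} (a e : Vec D × Fn D) : Fn D :=
  fun x => -(dot a.1 e.1 x) + a.2 x * e.2 x + 2 * dot a.1 (grad e.2) x

/-- μ₂ on K₂ ⊗ K₁: μ₂((E,e),(A,φ)) = μ₂((A,φ),(E,e)). -/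
def mu2₂₁ {D : ℕ} (e a : Vec D × Fn D) : Fn D := mu2₁₂ a e

/-- μ₂ on K₀ ⊗ K₃: μ₂(λ,N) = λN. -/
def mu2₀₃ {D : ℕ} (l N : Fn D) : Fn D := fmul l N

/-- μ₂ on K₃ ⊗ K₀: μ₂(N,λ) = λN. -/
def mu2₃₀ {D : ℕ} (N l : Fn D) : Fn D := fmul l N

theorem SmF.differentiable {D : ℕ} {f : Fn D} (hf : SmF f) : Differentiable ℝ f :=
  ContDiff.differentiable hf (by simp)

theorem SmF.pd {D : ℕ} {f : Fn D} (hf : SmF f) (μ : Fin D) : SmF (pd μ f) :=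
  (ContDiff.fderiv_right (m := (⊤ : ℕ∞)) hf (by simp)).clm_apply contDiff_const

theorem SmF.add {D : ℕ} {f g : Fn D} (hf : SmF f) (hg : SmF g) : SmF fun x => f x + g x :=
  ContDiff.add hf hg

theorem SmF.sub {D : ℕ} {f g : Fn D} (hf : SmF f) (hg : SmF g) : SmF fun x => f x - g x :=
  ContDiff.sub hf hg

theorem SmF.mul {D : ℕ} {f g : Fn D} (hf : SmF f) (hg : SmF g) : SmF fun x => f x * g x :=
  ContDiff.mul hf hg

theorem SmF.const_mul {D : ℕ} {f : Fn D} (c : ℝ) (hf : SmF f) : SmF fun x => c * f x :=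
  ContDiff.mul contDiff_const hf

theorem SmF.sum {D : ℕ} {ι : Type*} {s : Finset ι} {f : ι → Fn D} (hf : ∀ i, SmF (f i)) :
    SmF fun x => ∑ i ∈ s, f i x :=
  ContDiff.sum fun i _ => hf i

theorem SmV.smF {D : ℕ} {X : Vec D} (hX : SmV X) (μ : Fin D) : SmF fun x => X x μ := hX μ

theorem SmF.grad {D : ℕ} {f : Fn D} (hf : SmF f) : SmV (grad f) := fun μ => hf.pd μ

theorem SmV.dot {D : ℕ} {X Y : Vec D} (hX : SmV X) (hY : SmV Y) : SmF (dot X Y) :=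
  SmF.sum fun μ => ((hX.smF μ).const_mul _).mul (hY.smF μ)

theorem SmV.divg {D : ℕ} {X : Vec D} (hX : SmV X) : SmF (divg X) :=
  SmF.sum fun μ => ((hX.smF μ).pd μ).const_mul _

theorem SmV.starP {D : ℕ} {X Y : Vec D} (hX : SmV X) (hY : SmV Y) : SmV (starP X Y) :=
  fun μ => SmF.sum fun ν => SmF.const_mul _
    (((hX.smF ν).mul ((hY.smF μ).pd ν)).add
      ((((hX.smF ν).pd μ).sub ((hX.smF μ).pd ν)).mul (hY.smF ν)))

theorem pd_add {D : ℕ} {f g : Fn D} (hf : SmF f) (hg : SmF g) (μ : Fin D) :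
    pd μ (fun x => f x + g x) = fun x => pd μ f x + pd μ g x := by
  funext x
  simp only [pd]
  rw [fderiv_fun_add (hf.differentiable x) (hg.differentiable x)]
  rfl

theorem pd_sub {D : ℕ} {f g : Fn D} (hf : SmF f) (hg : SmF g) (μ : Fin D) :
    pd μ (fun x => f x - g x) = fun x => pd μ f x - pd μ g x := by
  funext x
  simp only [pd]
  rw [fderiv_fun_sub (hf.differentiable x) (hg.differentiable x)]
  rfl

theorem pd_mul {D : ℕ} {f g : Fn D} (hf : SmF f) (hg : SmF g) (μ : Fin D) :
    pd μ (fun x => f x * g x) = fun x => pd μ f x * g x + f x * pd μ g x := by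
  funext x
  simp only [pd]
  rw [fderiv_fun_mul (hf.differentiable x) (hg.differentiable x)]
  simp only [_root_.add_apply, _root_.smul_apply, smul_eq_mul]
  ring

theorem pd_fmul {D : ℕ} {f g : Fn D} (hf : SmF f) (hg : SmF g) (μ : Fin D) :
    pd μ (fmul f g) = fun x => pd μ f x * g x + f x * pd μ g x :=
  pd_mul hf hg μ

theorem pd_const_mul {D : ℕ} {f : Fn D} (hf : SmF f) (c : ℝ) (μ : Fin D) :
    pd μ (fun x => c * f x) = fun x => c * pd μ f x := by
  funext x
  simp only [pd]
  rw [fderiv_const_mul (hf.differentiable x)]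
  rfl

theorem pd_sum {D : ℕ} {ι : Type*} {s : Finset ι} {f : ι → Fn D} (hf : ∀ i, SmF (f i))
    (μ : Fin D) : pd μ (fun x => ∑ i ∈ s, f i x) = fun x => ∑ i ∈ s, pd μ (f i) x := by
  funext x
  simp only [pd]
  rw [fderiv_fun_sum fun i _ => (hf i).differentiable x]
  simp

theorem pd_comm {D : ℕ} {f : Fn D} (hf : SmF f) (μ ν : Fin D) :
    pd μ (pd ν f) = pd ν (pd μ f) := by
  funext x
  have hd : DifferentiableAt ℝ (fderiv ℝ f) x :=
    (ContDiff.fderiv_right (m := (⊤ : ℕ∞)) hf (by simp)).differentiable (by simp) x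
  have hs : IsSymmSndFDerivAt ℝ f x :=
    ContDiffAt.isSymmSndFDerivAt (ContDiff.contDiffAt hf) (by
      rw [minSmoothness_of_isRCLikeNormedField]
      exact WithTop.coe_le_coe.2 le_top)
  have key : ∀ α β : Fin D, pd α (pd β f) x
      = fderiv ℝ (fderiv ℝ f) x (Pi.single α 1) (Pi.single β 1) := by
    intro α β
    unfold pd
    rw [fderiv_clm_apply hd (differentiableAt_const _)]
    simp
  rw [key, key]
  exact hs _ _

theorem box_mul {D : ℕ} {f g : Fn D} (hf : SmF f) (hg : SmF g) (x : Pt D) :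
    box (fun y => f y * g y) x
      = box f x * g x + f x * box g x + 2 * dot (grad f) (grad g) x := by
  simp only [box, dot, grad, Finset.sum_mul, Finset.mul_sum, ← Finset.sum_add_distrib]
  refine Finset.sum_congr rfl fun μ _ => ?_
  rw [pd_mul hf hg, pd_add ((hf.pd μ).mul hg) (hf.mul (hg.pd μ)), pd_mul (hf.pd μ) hg,
    pd_mul hf (hg.pd μ)]
  ring

theorem box_fmul {D : ℕ} {f g : Fn D} (hf : SmF f) (hg : SmF g) (x : Pt D) :
    box (fmul f g) x = box f x * g x + f x * box g x + 2 * dot (grad f) (grad g) x :=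
  box_mul hf hg x

theorem divg_fsmul {D : ℕ} {f : Fn D} {X : Vec D} (hf : SmF f) (hX : SmV X) (x : Pt D) :
    divg (fsmul f X) x = dot (grad f) X x + f x * divg X x := by
  simp only [divg, dot, grad, fsmul, Finset.mul_sum, ← Finset.sum_add_distrib]
  refine Finset.sum_congr rfl fun μ _ => ?_
  rw [pd_mul hf (hX.smF μ)]
  ring

theorem divg_add {D : ℕ} {X Y : Vec D} (hX : SmV X) (hY : SmV Y) (x : Pt D) :
    divg (fun y μ => X y μ + Y y μ) x = divg X x + divg Y x := by
  simp only [divg, ← Finset.sum_add_distrib]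
  refine Finset.sum_congr rfl fun μ _ => ?_
  rw [pd_add (hX.smF μ) (hY.smF μ)]
  ring

theorem divg_sub {D : ℕ} {X Y : Vec D} (hX : SmV X) (hY : SmV Y) (x : Pt D) :
    divg (fun y μ => X y μ - Y y μ) x = divg X x - divg Y x := by
  simp only [divg, ← Finset.sum_sub_distrib]
  refine Finset.sum_congr rfl fun μ _ => ?_
  rw [pd_sub (hX.smF μ) (hY.smF μ)]
  ring

theorem divg_const_mul {D : ℕ} {X : Vec D} (hX : SmV X) (c : ℝ) (x : Pt D) :
    divg (fun y μ => c * X y μ) x = c * divg X x := by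
  simp only [divg, Finset.mul_sum]
  refine Finset.sum_congr rfl fun μ _ => ?_
  rw [pd_const_mul (hX.smF μ)]
  ring

theorem dot_comm {D : ℕ} (X Y : Vec D) (x : Pt D) : dot X Y x = dot Y X x :=
  Finset.sum_congr rfl fun _ _ => by ring

theorem dot_sub {D : ℕ} (X Y Z : Vec D) (x : Pt D) :
    dot X (fun y μ => Y y μ - Z y μ) x = dot X Y x - dot X Z x := by
  simp only [dot, ← Finset.sum_sub_distrib]
  exact Finset.sum_congr rfl fun _ _ => by ring

theorem grad_sub {D : ℕ} {f g : Fn D} (hf : SmF f) (hg : SmF g) :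
    grad (fun x => f x - g x) = fun x μ => grad f x μ - grad g x μ := by
  funext x μ
  simp only [grad, pd_sub hf hg]

theorem pd_dot {D : ℕ} {X Y : Vec D} (hX : SmV X) (hY : SmV Y) (μ : Fin D) :
    pd μ (dot X Y) = fun x => ∑ ν, (eta D ν * pd μ (fun y => X y ν) x * Y x ν
      + eta D ν * X x ν * pd μ (fun y => Y y ν) x) := by
  unfold dot
  rw [pd_sum fun ν => ((hX.smF ν).const_mul _).mul (hY.smF ν)]
  funext x
  refine Finset.sum_congr rfl fun ν _ => ?_
  rw [pd_mul ((hX.smF ν).const_mul _) (hY.smF ν), pd_const_mul (hX.smF ν)]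

theorem box_dot {D : ℕ} {X Y : Vec D} (hX : SmV X) (hY : SmV Y) (x : Pt D) :
    box (dot X Y) x = dot (boxV X) Y x + dot X (boxV Y) x
      + 2 * ∑ μ, ∑ ν, eta D μ * eta D ν
        * (pd μ (fun y => X y ν) x * pd μ (fun y => Y y ν) x) := by
  have h : ∀ μ, pd μ (pd μ (dot X Y)) x = ∑ ν, eta D ν *
      (pd μ (pd μ fun y => X y ν) x * Y x ν + X x ν * pd μ (pd μ fun y => Y y ν) x
        + 2 * (pd μ (fun y => X y ν) x * pd μ (fun y => Y y ν) x)) := by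
    intro μ
    have hA (ν : Fin D) := (((hX.smF ν).pd μ).const_mul (eta D ν)).mul (hY.smF ν)
    have hB (ν : Fin D) := ((hX.smF ν).const_mul (eta D ν)).mul ((hY.smF ν).pd μ)
    rw [pd_dot hX hY, pd_sum fun ν => (hA ν).add (hB ν)]
    refine Finset.sum_congr rfl fun ν _ => ?_
    rw [pd_add (hA ν) (hB ν), pd_mul (((hX.smF ν).pd μ).const_mul _) (hY.smF ν),
      pd_mul ((hX.smF ν).const_mul _) ((hY.smF ν).pd μ), pd_const_mul ((hX.smF ν).pd μ),
      pd_const_mul (hX.smF ν)]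
    ring
  have h_left : dot (boxV X) Y x = ∑ μ, ∑ ν, eta D μ * eta D ν
      * (pd μ (pd μ fun y => X y ν) x * Y x ν) := by
    rw [Finset.sum_comm]
    simp only [dot, boxV, box, Finset.mul_sum, Finset.sum_mul]
    exact Finset.sum_congr rfl fun ν _ => Finset.sum_congr rfl fun μ _ => by ring
  have h_right : dot X (boxV Y) x = ∑ μ, ∑ ν, eta D μ * eta D ν
      * (X x ν * pd μ (pd μ fun y => Y y ν) x) := by
    rw [Finset.sum_comm]
    simp only [dot, boxV, box, Finset.mul_sum]
    exact Finset.sum_congr rfl fun ν _ => Finset.sum_congr rfl fun μ _ => by ring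
  rw [h_left, h_right]
  simp only [box, h, Finset.mul_sum, ← Finset.sum_add_distrib]
  exact Finset.sum_congr rfl fun μ _ => Finset.sum_congr rfl fun ν _ => by ring

theorem grad_divg {D : ℕ} {X : Vec D} (hX : SmV X) :
    grad (divg X) = fun x μ => ∑ ν, eta D ν * pd ν (pd μ fun y => X y ν) x := by
  funext x μ
  unfold grad divg
  rw [pd_sum fun ν => ((hX.smF ν).pd ν).const_mul _]
  refine Finset.sum_congr rfl fun ν _ => ?_
  rw [pd_const_mul ((hX.smF ν).pd ν), pd_comm (hX.smF ν)]

theorem divg_starP {D : ℕ} {X Y : Vec D} (hX : SmV X) (hY : SmV Y) (x : Pt D) :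
    divg (starP X Y) x = dot X (grad (divg Y)) x + dot (boxV X) Y x - dot Y (grad (divg X)) x
      + ∑ μ, ∑ ν, eta D μ * eta D ν
        * (pd μ (fun y => X y ν) x * pd μ (fun y => Y y ν) x) := by
  have h : ∀ μ, pd μ (fun y => starP X Y y μ) x = ∑ ν, eta D ν *
      (pd μ (fun y => X y ν) x * pd ν (fun y => Y y μ) x
        + X x ν * pd μ (pd ν fun y => Y y μ) x
        + (pd μ (pd μ fun y => X y ν) x - pd μ (pd ν fun y => X y μ) x) * Y x ν
        + (pd μ (fun y => X y ν) x - pd ν (fun y => X y μ) x) * pd μ (fun y => Y y ν) x) := by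
    intro μ
    have hA (ν : Fin D) := (hX.smF ν).mul ((hY.smF μ).pd ν)
    have hF (ν : Fin D) := ((hX.smF ν).pd μ).sub ((hX.smF μ).pd ν)
    have hB (ν : Fin D) := (hF ν).mul (hY.smF ν)
    unfold starP
    rw [pd_sum fun ν => ((hA ν).add (hB ν)).const_mul _]
    refine Finset.sum_congr rfl fun ν _ => ?_
    rw [pd_const_mul ((hA ν).add (hB ν)), pd_add (hA ν) (hB ν),
      pd_mul (hX.smF ν) ((hY.smF μ).pd ν), pd_mul (hF ν) (hY.smF ν),
      pd_sub ((hX.smF ν).pd μ) ((hX.smF μ).pd ν)]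
    ring
  have hswap : ∑ μ, ∑ ν, eta D μ * eta D ν
        * (pd ν (fun y => X y μ) x * pd μ (fun y => Y y ν) x)
      = ∑ μ, ∑ ν, eta D μ * eta D ν
        * (pd μ (fun y => X y ν) x * pd ν (fun y => Y y μ) x) := by
    rw [Finset.sum_comm]
    exact Finset.sum_congr rfl fun ν _ => Finset.sum_congr rfl fun μ _ => by ring
  have h1 : dot X (grad (divg Y)) x = ∑ μ, ∑ ν, eta D μ * eta D ν
      * (X x ν * pd μ (pd ν fun y => Y y μ) x) := by
    rw [grad_divg hY, Finset.sum_comm]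
    simp only [dot, Finset.mul_sum]
    exact Finset.sum_congr rfl fun ν _ => Finset.sum_congr rfl fun μ _ => by ring
  have h2 : dot Y (grad (divg X)) x = ∑ μ, ∑ ν, eta D μ * eta D ν
      * (pd μ (pd ν fun y => X y μ) x * Y x ν) := by
    rw [grad_divg hX, Finset.sum_comm]
    simp only [dot, Finset.mul_sum]
    exact Finset.sum_congr rfl fun ν _ => Finset.sum_congr rfl fun μ _ => by ring
  have h3 : dot (boxV X) Y x = ∑ μ, ∑ ν, eta D μ * eta D ν
      * (pd μ (pd μ fun y => X y ν) x * Y x ν) := by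
    rw [Finset.sum_comm]
    simp only [dot, boxV, box, Finset.mul_sum, Finset.sum_mul]
    exact Finset.sum_congr rfl fun ν _ => Finset.sum_congr rfl fun μ _ => by ring
  rw [h1, h2, h3, ← add_sub_cancel_right (divg (starP X Y) x) (∑ μ, ∑ ν, eta D μ * eta D ν
        * (pd ν (fun y => X y μ) x * pd μ (fun y => Y y ν) x))]
  rw [sub_eq_iff_eq_add]
  nth_rw 2 [hswap]
  rw [sub_add_eq_add_sub, sub_add_eq_add_sub, eq_sub_iff_add_eq]
  simp only [divg, h, Finset.mul_sum, ← Finset.sum_add_distrib]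
  exact Finset.sum_congr rfl fun μ _ => Finset.sum_congr rfl fun ν _ => by ring

theorem starP_grad_left {D : ℕ} {f : Fn D} (hf : SmF f) (Y : Vec D) (x : Pt D) (μ : Fin D) :
    starP (grad f) Y x μ = dot (grad f) (grad fun y => Y y μ) x := by
  simp only [starP, dot, grad]
  refine Finset.sum_congr rfl fun ν _ => ?_
  rw [show (fun y => pd ν f y) = pd ν f from rfl, show (fun y => pd μ f y) = pd μ f from rfl,
    pd_comm hf μ ν]
  ring

theorem grad_dot_grad {D : ℕ} {f : Fn D} {X : Vec D} (hf : SmF f) (hX : SmV X) (x : Pt D)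
    (μ : Fin D) :
    grad (dot X (grad f)) x μ = starP X (grad f) x μ + dot (grad f) (grad fun y => X y μ) x := by
  simp only [grad, pd_dot hX hf.grad, starP, dot, ← Finset.sum_add_distrib]
  refine Finset.sum_congr rfl fun ν _ => ?_
  rw [show (fun y => pd ν f y) = pd ν f from rfl, show (fun y => pd μ f y) = pd μ f from rfl,
    pd_comm hf μ ν]
  ring

/-- the Yang–Mills kinematic differential m₁ satisfies the graded Leibniz
rule with respect to the worldline vertex-operator product μ₂, in all components of the
kinematic complex K (degrees of outputs at most 3). -/
theorem m1_graded_leibniz_mu2 {D : ℕ} (hD : 1 ≤ D)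
    (l l1 l2 : Fn D) (a a1 a2 e : Vec D × Fn D)
    (hl : SmF l) (hl1 : SmF l1) (hl2 : SmF l2)
    (haV : SmV a.1) (haF : SmF a.2) (ha1V : SmV a1.1) (ha1F : SmF a1.2)
    (ha2V : SmV a2.1) (ha2F : SmF a2.2) (heV : SmV e.1) (heF : SmF e.2) :
    -- (i)  m₁(λ₁λ₂) = μ₂(m₁λ₁, λ₂) + μ₂(λ₁, m₁λ₂)  in K₁
    m1₀ (mu2₀₀ l1 l2) = mu2₁₀ (m1₀ l1) l2 + mu2₀₁ l1 (m1₀ l2) ∧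
    -- (ii)  m₁(μ₂(λ,(A,φ))) = μ₂(m₁λ,(A,φ)) + μ₂(λ, m₁(A,φ))  in K₂
    m1₁ (mu2₀₁ l a) = mu2₁₁ (m1₀ l) a + mu2₀₂ l (m1₁ a) ∧
    -- (iii)  m₁(μ₂((A,φ),λ)) = μ₂(m₁(A,φ),λ) − μ₂((A,φ), m₁λ)  in K₂
    m1₁ (mu2₁₀ a l) = mu2₂₀ (m1₁ a) l - mu2₁₁ a (m1₀ l) ∧
    -- (iv)  m₁(μ₂((A₁,φ₁),(A₂,φ₂))) = μ₂(m₁(A₁,φ₁),(A₂,φ₂)) − μ₂((A₁,φ₁), m₁(A₂,φ₂))  in K₃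
    m1₂ (mu2₁₁ a1 a2) = mu2₂₁ (m1₁ a1) a2 - mu2₁₂ a1 (m1₁ a2) ∧
    -- (v)  m₁(μ₂(λ,(E,e))) = μ₂(m₁λ,(E,e)) + μ₂(λ, m₁(E,e))  in K₃
    m1₂ (mu2₀₂ l e) = mu2₁₂ (m1₀ l) e + mu2₀₃ l (m1₂ e) ∧
    -- (vi)  m₁(μ₂((E,e),λ)) = μ₂(m₁(E,e),λ) + μ₂((E,e), m₁λ)  in K₃
    m1₂ (mu2₂₀ e l) = mu2₃₀ (m1₂ e) l + mu2₂₁ e (m1₀ l) := by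
  have h_scalar : ∀ (f : Fn D) (b : Vec D × Fn D), SmF f → SmV b.1 → SmF b.2 →
      m1₂ (mu2₀₂ f b) = mu2₁₂ (m1₀ f) b + mu2₀₃ f (m1₂ b) := by
    intro f b hf hbV hbF
    funext x
    simp only [m1₂, mu2₀₂, mu2₁₂, m1₀, mu2₀₃, Pi.add_apply, box_fmul hf hbF,
      divg_fsmul hf hbV]
    simp only [fmul, m1₂]
    ring
  refine ⟨?_, ?_, ?_, ?_, h_scalar l e hl heV heF, ?_⟩
  · refine Prod.ext ?_ ?_
    · funext x μ
      simp only [m1₀, mu2₀₀, mu2₁₀, mu2₀₁, fsmul, grad, pd_fmul hl1 hl2, Prod.fst_add,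
        Pi.add_apply]
      ring
    · funext x
      simp only [m1₀, mu2₀₀, mu2₁₀, mu2₀₁, box_fmul hl1 hl2, Prod.snd_add, Pi.add_apply]
      simp only [fmul]
      ring
  · refine Prod.ext ?_ ?_
    · funext x μ
      simp only [m1₀, m1₁, mu2₀₁, mu2₁₁, mu2₀₂, boxV, fsmul, Prod.fst_add, Pi.add_apply,
        box_mul hl (haV.smF μ), starP_grad_left hl]
      simp only [grad, pd_fmul hl haF]
      ring
    · funext x
      simp only [m1₀, m1₁, mu2₀₁, mu2₁₁, mu2₀₂, fmul, Prod.snd_add, Pi.add_apply,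
        divg_fsmul hl haV]
      ring
  · refine Prod.ext ?_ ?_
    · funext x μ
      have h_grad : grad (fun y => l y * a.2 y + 2 * dot a.1 (grad l) y) x μ
          = grad l x μ * a.2 x + l x * grad a.2 x μ + 2 * grad (dot a.1 (grad l)) x μ := by
        have h_dot := haV.dot hl.grad
        simp only [grad] at h_dot ⊢
        rw [pd_add (hl.mul haF) (h_dot.const_mul 2), pd_mul hl haF, pd_const_mul h_dot]
      simp only [m1₀, m1₁, mu2₁₀, mu2₁₁, mu2₂₀, boxV, fsmul, Prod.fst_sub, Pi.sub_apply,
        box_mul hl (haV.smF μ), h_grad, grad_dot_grad hl haV]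
      ring
    · funext x
      simp only [m1₀, m1₁, mu2₁₀, mu2₁₁, mu2₂₀, fmul, Prod.snd_sub, Pi.sub_apply,
        divg_fsmul hl haV, dot_comm a.1]
      ring
  · funext x
    have h1 : SmV (fsmul a1.2 a2.1) := fun μ => ha1F.mul (ha2V.smF μ)
    have h2 : SmV (fsmul a2.2 a1.1) := fun μ => ha2F.mul (ha1V.smF μ)
    have h3 : SmV (fun y μ => 2 * starP a1.1 a2.1 y μ) :=
      fun μ => ((ha1V.starP ha2V).smF μ).const_mul 2
    have h12 : SmV (fun y μ => fsmul a1.2 a2.1 y μ - fsmul a2.2 a1.1 y μ) :=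
      fun μ => (h1.smF μ).sub (h2.smF μ)
    have h_divg : divg (mu2₁₁ a1 a2).1 x = dot (grad a1.2) a2.1 x + a1.2 x * divg a2.1 x
        - (dot (grad a2.2) a1.1 x + a2.2 x * divg a1.1 x) + 2 * divg (starP a1.1 a2.1) x := by
      rw [← divg_fsmul ha1F ha2V, ← divg_fsmul ha2F ha1V, ← divg_const_mul (ha1V.starP ha2V),
        ← divg_sub h1 h2, ← divg_add h12 h3]
      rfl
    simp only [m1₂, h_divg, divg_starP ha1V ha2V]
    simp only [mu2₁₁, mu2₂₁, mu2₁₂, m1₁, Pi.sub_apply, box_dot ha1V ha2V,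
      grad_sub ha1V.divg ha1F, grad_sub ha2V.divg ha2F, dot_sub, dot_comm (boxV a1.1) a2.1,
      dot_comm (grad a1.2) a2.1, dot_comm (grad a2.2) a1.1]
    ring
  · have h := h_scalar l e hl heV heF
    rw [add_comm] at h
    exact h
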